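/- For n = 18 and the partition J of {1,...,18} into consecutive blocks of sizes 1,5,6,5,1, the variety NT_18^J of commuting pairs of block-strictly-upper-triangular matrices has dimension at least 188; hence CT_18 contains a subvariety of dimension at least 190 > 189 = dim CT_18^0, so CT_18 is not a complete intersection. -/

import Mathlib

open Matrix Polynomial

/-- Points of the affine space `T_n × T_n` (resp. `U_n × U_n`), encoded as functions
from (index pairs for X) ⊕ (index pairs for Y) to the field. -/
abbrev Pt (n : ℕ) (K : Type*) := ((Fin n × Fin n) ⊕ (Fin n × Fin n)) → K

/-- The Zariski topology on the affine space of pairs of matrices: generated by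
complements of zero loci of polynomials. -/
noncomputable instance ptTop (n : ℕ) (K : Type*) [CommRing K] : TopologicalSpace (Pt n K) :=
  TopologicalSpace.generateFrom
    { U | ∃ p : MvPolynomial ((Fin n × Fin n) ⊕ (Fin n × Fin n)) K,
        U = {x | MvPolynomial.eval x p ≠ 0} }

/-- The first matrix of the pair encoded by a point. -/
def Xof {n : ℕ} {K : Type*} (x : Pt n K) : Matrix (Fin n) (Fin n) K :=
  Matrix.of fun i j => x (Sum.inl (i, j))

/-- The second matrix of the pair encoded by a point. -/
def Yof {n : ℕ} {K : Type*} (x : Pt n K) : Matrix (Fin n) (Fin n) K :=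
  Matrix.of fun i j => x (Sum.inr (i, j))

/-- `CT_n`: pairs of commuting upper triangular matrices. -/
def CTset (n : ℕ) (K : Type*) [CommRing K] : Set (Pt n K) :=
  {x | (∀ i j, j < i → Xof x i j = 0) ∧ (∀ i j, j < i → Yof x i j = 0) ∧
    Xof x * Yof x = Yof x * Xof x}

/-- `NT_n`: pairs of commuting strictly upper triangular matrices. -/
def NTset (n : ℕ) (K : Type*) [CommRing K] : Set (Pt n K) :=
  {x | (∀ i j, j ≤ i → Xof x i j = 0) ∧ (∀ i j, j ≤ i → Yof x i j = 0) ∧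
    Xof x * Yof x = Yof x * Xof x}

/-- `CT_n^0`: the Zariski closure of the set of commuting pairs of regular
(minimal polynomial of degree `n`) upper triangular matrices. -/
def CT0 (n : ℕ) (K : Type*) [Field K] : Set (Pt n K) :=
  closure {x | x ∈ CTset n K ∧ (minpoly K (Xof x)).natDegree = n ∧
    (minpoly K (Yof x)).natDegree = n}

/-- The block index for the partition of `{1,…,18}` into consecutive blocks of sizes
`1, 5, 6, 5, 1`. -/
def blk (i : Fin 18) : ℕ :=
  if (i : ℕ) < 1 then 0 else if (i : ℕ) < 6 then 1 else if (i : ℕ) < 12 then 2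
    else if (i : ℕ) < 17 then 3 else 4

/-- `NT_18^J`: commuting pairs of strictly upper triangular `18 × 18` matrices whose
entries with both indices in the same block of `J` vanish. -/
def NTJ (K : Type*) [CommRing K] : Set (Pt 18 K) :=
  {x | x ∈ NTset 18 K ∧ ∀ i j : Fin 18, blk i = blk j → Xof x i j = 0 ∧ Yof x i j = 0}

/-- A function on affine space that is given by a polynomial. -/
def IsPolyFun {σ K : Type*} [CommRing K] (f : (σ → K) → K) : Prop :=
  ∃ p : MvPolynomial σ K, ∀ a, MvPolynomial.eval a p = f a

namespace IsPolyFun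

variable {σ τ K : Type*} [CommRing K] {f g : (σ → K) → K}

theorem const (c : K) : IsPolyFun fun _ : σ → K => c := ⟨MvPolynomial.C c, by simp⟩

theorem coord (s : σ) : IsPolyFun fun a : σ → K => a s := ⟨MvPolynomial.X s, by simp⟩

theorem add (hf : IsPolyFun f) (hg : IsPolyFun g) : IsPolyFun fun a => f a + g a := by
  obtain ⟨p, hp⟩ := hf
  obtain ⟨q, hq⟩ := hg
  exact ⟨p + q, by simp [hp, hq]⟩

theorem sub (hf : IsPolyFun f) (hg : IsPolyFun g) : IsPolyFun fun a => f a - g a := by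
  obtain ⟨p, hp⟩ := hf
  obtain ⟨q, hq⟩ := hg
  exact ⟨p - q, by simp [hp, hq]⟩

theorem mul (hf : IsPolyFun f) (hg : IsPolyFun g) : IsPolyFun fun a => f a * g a := by
  obtain ⟨p, hp⟩ := hf
  obtain ⟨q, hq⟩ := hg
  exact ⟨p * q, by simp [hp, hq]⟩

theorem sum {ι : Type*} (s : Finset ι) {F : ι → (σ → K) → K} (hF : ∀ i, IsPolyFun (F i)) :
    IsPolyFun fun a => ∑ i ∈ s, F i a := by
  choose p hp using hF
  exact ⟨∑ i ∈ s, p i, by simp [hp]⟩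

theorem prod {ι : Type*} (s : Finset ι) {F : ι → (σ → K) → K} (hF : ∀ i, IsPolyFun (F i)) :
    IsPolyFun fun a => ∏ i ∈ s, F i a := by
  choose p hp using hF
  exact ⟨∏ i ∈ s, p i, by simp [hp]⟩

theorem comp (hf : IsPolyFun f) {G : (τ → K) → σ → K} (hG : ∀ s, IsPolyFun fun a => G a s) :
    IsPolyFun fun a => f (G a) := by
  obtain ⟨p, hp⟩ := hf
  choose q hq using hG
  refine ⟨MvPolynomial.bind₁ q p, fun a => ?_⟩
  have hG' : G a = fun s => MvPolynomial.eval a (q s) := funext fun s => (hq s a).symm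
  change _ = f (G a)
  rw [← hp, hG', MvPolynomial.eval, MvPolynomial.eval₂Hom_bind₁]
  rfl

variable {ι : Type*} [Fintype ι] {A B : (σ → K) → Matrix ι ι K}

theorem matrix_mul (hA : ∀ i j, IsPolyFun fun a => A a i j) (hB : ∀ i j, IsPolyFun fun a => B a i j)
    (i j : ι) : IsPolyFun fun a => (A a * B a) i j := by
  simp only [Matrix.mul_apply]
  exact sum _ fun k => (hA i k).mul (hB k j)

theorem mulVec (hA : ∀ i j, IsPolyFun fun a => A a i j) {v : (σ → K) → ι → K}
    (hv : ∀ i, IsPolyFun fun a => v a i) (i : ι) : IsPolyFun fun a => (A a *ᵥ v a) i := by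
  simp only [Matrix.mulVec, dotProduct]
  exact sum _ fun k => (hA i k).mul (hv k)

variable [DecidableEq ι]

theorem det (hA : ∀ i j, IsPolyFun fun a => A a i j) : IsPolyFun fun a => (A a).det := by
  simp only [Matrix.det_apply']
  exact sum _ fun s => (const _).mul (prod _ fun i => hA _ _)

theorem adjugate (hA : ∀ i j, IsPolyFun fun a => A a i j) (i j : ι) :
    IsPolyFun fun a => (A a).adjugate i j := by
  simp only [Matrix.adjugate_apply]
  refine det fun k l => ?_
  by_cases hk : k = j
  · subst hk
    simpa using const _
  · simpa [Matrix.updateRow_ne hk] using hA k l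

theorem exists_mul_ne_zero {K : Type*} [Field K] [Infinite K] {f g : (σ → K) → K}
    (hf : IsPolyFun f) (hg : IsPolyFun g) (hf0 : ∃ a, f a ≠ 0) (hg0 : ∃ a, g a ≠ 0) :
    ∃ a, f a ≠ 0 ∧ g a ≠ 0 := by
  obtain ⟨p, hp⟩ := hf
  obtain ⟨q, hq⟩ := hg
  by_contra! H
  have hpq : p * q = 0 := MvPolynomial.funext fun a => by
    by_cases ha : f a = 0
    · simp [hp, ha]
    · simp [hq, H a ha]
  rcases mul_eq_zero.mp hpq with rfl | rfl
  · exact hf0.elim fun a ha => ha (by simp [← hp])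
  · exact hg0.elim fun a ha => ha (by simp [← hq])

end IsPolyFun

theorem exists_eval_ne_zero_of_isOpen {n : ℕ} {K : Type*} [Field K] {U : Set (Pt n K)}
    (hU : IsOpen U) {x : Pt n K} (hx : x ∈ U) :
    ∃ p : MvPolynomial ((Fin n × Fin n) ⊕ (Fin n × Fin n)) K,
      MvPolynomial.eval x p ≠ 0 ∧ {y | MvPolynomial.eval y p ≠ 0} ⊆ U := by
  induction hU with
  | basic s hs =>
    obtain ⟨p, rfl⟩ := hs
    exact ⟨p, hx, subset_rfl⟩
  | univ => exact ⟨1, by simp, Set.subset_univ _⟩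
  | inter s t _ _ hs ht =>
    obtain ⟨p, hp, hps⟩ := hs hx.1
    obtain ⟨q, hq, hqt⟩ := ht hx.2
    refine ⟨p * q, by simp [hp, hq], fun y hy => ?_⟩
    simp only [map_mul, ne_eq, mul_eq_zero, not_or, Set.mem_ofPred_eq] at hy
    exact ⟨hps hy.1, hqt hy.2⟩
  | sUnion S _ ih =>
    obtain ⟨s, hs, hxs⟩ := hx
    obtain ⟨p, hp, hps⟩ := ih s hs hxs
    exact ⟨p, hp, hps.trans (Set.subset_sUnion_of_mem hs)⟩

theorem isClosed_setOf_coord_eq {n : ℕ} {K : Type*} [Field K]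
    (c : (Fin n × Fin n) ⊕ (Fin n × Fin n)) (b : K) : IsClosed {x : Pt n K | x c = b} := by
  refine ⟨TopologicalSpace.isOpen_generateFrom_of_mem
    ⟨MvPolynomial.X c - MvPolynomial.C b, ?_⟩⟩
  ext x
  simp [sub_eq_zero]

section Dimension

variable {n : ℕ} {K σ T : Type*} [Field K] [Infinite K] [TopologicalSpace T] {e : T → Pt n K}

theorem isIrreducible_range_of_isPolyFun (he : Topology.IsInducing e) (ψ : (σ → K) → T)
    (hψ : ∀ c, IsPolyFun fun a => e (ψ a) c) : IsIrreducible (Set.range ψ) := by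
  refine ⟨Set.range_nonempty ψ, ?_⟩
  rintro U V hU hV ⟨_, ⟨a, rfl⟩, ha⟩ ⟨_, ⟨b, rfl⟩, hb⟩
  obtain ⟨U, hU', rfl⟩ := he.isOpen_iff.mp hU
  obtain ⟨V, hV', rfl⟩ := he.isOpen_iff.mp hV
  obtain ⟨p, hp, hpU⟩ := exists_eval_ne_zero_of_isOpen hU' ha
  obtain ⟨q, hq, hqV⟩ := exists_eval_ne_zero_of_isOpen hV' hb
  have hpoly (r : MvPolynomial ((Fin n × Fin n) ⊕ (Fin n × Fin n)) K) :
      IsPolyFun fun a => MvPolynomial.eval (e (ψ a)) r :=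
    IsPolyFun.comp (f := fun x => MvPolynomial.eval x r) ⟨r, fun _ => rfl⟩ hψ
  obtain ⟨x, hxp, hxq⟩ := (hpoly p).exists_mul_ne_zero (hpoly q) ⟨a, hp⟩ ⟨b, hq⟩
  exact ⟨ψ x, ⟨x, rfl⟩, hpU hxp, hqV hxq⟩

/-- A space containing the image of a polynomial map that recovers each of its parameters up to a
generically nonzero polynomial factor has dimension at least the number of parameters. -/
theorem card_le_topologicalKrullDim [Fintype σ] (he : Topology.IsInducing e) (ψ : (σ → K) → T)
    (hψ : ∀ c, IsPolyFun fun a => e (ψ a) c) (l : σ → (Fin n × Fin n) ⊕ (Fin n × Fin n))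
    (b : σ → K) (D : σ → (σ → K) → K) (hD : ∀ s, IsPolyFun (D s)) (hD0 : ∀ s, D s 0 ≠ 0)
    (h : ∀ a s, e (ψ a) (l s) = b s + a s * D s a) :
    ((Fintype.card σ : ℕ) : WithBot ℕ∞) ≤ topologicalKrullDim T := by
  classical
  let r := Fintype.equivFin σ
  let P (k : ℕ) (a : σ → K) (s : σ) : K := if (r s : ℕ) < k then a s else 0
  have hP (k : ℕ) (s : σ) : IsPolyFun fun a => P k a s := by
    by_cases hs : (r s : ℕ) < k
    · simpa [P, hs] using IsPolyFun.coord s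
    · simpa [P, hs] using IsPolyFun.const (0 : K)
  let Z (k : ℕ) : TopologicalSpace.IrreducibleCloseds T :=
    ⟨closure (Set.range fun a => ψ (P k a)), (isIrreducible_range_of_isPolyFun he _
      fun c => (hψ c).comp (hP k)).closure, isClosed_closure⟩
  have hmono {k m : ℕ} (hkm : k ≤ m) : Z k ≤ Z m := by
    refine closure_mono ?_
    rintro _ ⟨a, rfl⟩
    refine ⟨P k a, congrArg ψ (funext fun s => ?_)⟩
    simp only [P]
    split_ifs <;> first | rfl | omega
  have hstrict (k : ℕ) (hk : k < Fintype.card σ) : ¬ Z (k + 1) ≤ Z k := by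
    intro hle
    let s := r.symm ⟨k, hk⟩
    have hs : (r s : ℕ) = k := by simp [s]
    have hline (t : K) : P (k + 1) (Pi.single s t) = Pi.single s t := by
      funext u
      by_cases hu : u = s
      · subst hu
        simp [P, hs]
      · simp [P, hu]
    have hzero : ∀ x ∈ Z k, e x (l s) = b s := by
      refine closure_minimal (t := {x | e x (l s) = b s}) ?_
        ((isClosed_setOf_coord_eq (l s) (b s)).preimage he.continuous)
      rintro _ ⟨a, rfl⟩
      simp [h, P, hs]
    have hpoly : IsPolyFun fun t : Unit → K => D s (Pi.single s (t ())) :=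
      (hD s).comp fun u => by
        by_cases hu : u = s
        · subst hu
          simpa using IsPolyFun.coord ()
        · simpa [hu] using IsPolyFun.const (0 : K)
    obtain ⟨t, ht, htD⟩ := (IsPolyFun.coord (K := K) ()).exists_mul_ne_zero hpoly
      ⟨fun _ => 1, one_ne_zero⟩ ⟨0, by simpa using hD0 s⟩
    have hmem : ψ (Pi.single s (t ())) ∈ Z (k + 1) :=
      subset_closure ⟨Pi.single s (t ()), congrArg ψ (hline (t ()))⟩
    have := hzero _ (hle hmem)
    rw [h] at this
    simp [ht, htD] at this
  have hlt : StrictMono fun k : Fin (Fintype.card σ + 1) => Z k :=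
    Fin.strictMono_iff_lt_succ.mpr fun k =>
      lt_of_le_not_ge (hmono (by simp)) (hstrict k k.2)
  exact Order.LTSeries.length_le_krullDim (LTSeries.mk (Fintype.card σ) _ hlt)

end Dimension

/-- The positions of a block strictly upper triangular matrix. -/
abbrev BlockPos := {p : Fin 18 × Fin 18 // blk p.1 < blk p.2}

/-- The positions at which a commutator of block strictly upper triangular matrices
need not vanish. -/
abbrev CommPos := {p : Fin 18 × Fin 18 // blk p.1 + 2 ≤ blk p.2}

/-- The support of the base point: a nilpotent matrix in Jordan form up to reordering, whose
blocks of sizes `5 × 6` and `6 × 5` have full rank. -/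
def baseRel (i j : Fin 18) : Prop :=
  (i = 0 ∧ j = 1) ∨ (blk i = 1 ∧ (j : ℕ) = i + 5) ∨
    (blk i = 2 ∧ blk j = 3 ∧ (j : ℕ) = i + 6) ∨ (i = 12 ∧ j = 17)

instance : DecidableRel baseRel := fun _ _ => by unfold baseRel; infer_instance

/-- The position of `Y` for which the equation of `[X, Y] = 0` at a given position is solved
when `X` is the base point. -/
def pivot (p : Fin 18 × Fin 18) : Fin 18 × Fin 18 :=
  if p.1 = 0 then
    if p.2 = 11 then (1, 11)
    else if p.2 = 17 then (0, 12)
    else if p.2 < 12 then (0, p.2 - 5) else (0, p.2 - 6)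
  else if p.2 = 17 then
    if p.1 = 11 then (11, 12) else if p.1 < 6 then (p.1 + 5, 17) else (p.1 + 6, 17)
  else (p.1, p.2 - 6)

/-- The positions of `Y` that stay free. -/
abbrev FreePos := {p : BlockPos // ∀ e : CommPos, pivot e.1 ≠ p.1}

theorem card_blockPos_sum_freePos : Fintype.card (BlockPos ⊕ FreePos) = 188 := by
  have hB : Fintype.card BlockPos = 118 := by decide +kernel
  have hF : Fintype.card FreePos = 70 := by decide +kernel
  rw [Fintype.card_sum, hB, hF]

theorem blk_pivot_lt : ∀ e : CommPos, blk (pivot e.1).1 < blk (pivot e.1).2 := by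
  decide +kernel

theorem blk_lt_of_baseRel : ∀ i j, baseRel i j → blk i < blk j := by decide +kernel

theorem blk_monotone : ∀ i j, i ≤ j → blk i ≤ blk j := by decide +kernel

theorem baseRel_pivot_self (e : CommPos) :
    Xor ((pivot e.1).2 = e.1.2 ∧ baseRel e.1.1 (pivot e.1).1)
      ((pivot e.1).1 = e.1.1 ∧ baseRel (pivot e.1).2 e.1.2) := by
  unfold Xor
  revert e
  decide +kernel

theorem eq_or_of_baseRel_pivot : ∀ e f : CommPos,
    ((pivot f.1).2 = e.1.2 ∧ baseRel e.1.1 (pivot f.1).1) ∨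
      ((pivot f.1).1 = e.1.1 ∧ baseRel (pivot f.1).2 e.1.2) →
    f = e ∨ (e.1.1 = 0 ∧ f.1.1 ≠ 0) := by
  decide +kernel

section CommutingPairs

variable {K : Type*} [Field K]

/-- The point encoding a pair of matrices. -/
def toPt (X Y : Matrix (Fin 18) (Fin 18) K) : Pt 18 K :=
  Sum.elim (fun p => X p.1 p.2) fun p => Y p.1 p.2

/-- Block strictly upper triangular matrices. -/
def IsBlockUpper (A : Matrix (Fin 18) (Fin 18) K) : Prop :=
  ∀ i j, blk j ≤ blk i → A i j = 0

theorem IsBlockUpper.mul_apply_eq_zero {A B : Matrix (Fin 18) (Fin 18) K} (hA : IsBlockUpper A)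
    (hB : IsBlockUpper B) {i j : Fin 18} (h : ¬ blk i + 2 ≤ blk j) : (A * B) i j = 0 := by
  rw [Matrix.mul_apply]
  refine Finset.sum_eq_zero fun k _ => ?_
  by_cases hik : blk k ≤ blk i
  · rw [hA i k hik, zero_mul]
  · rw [hB k j (by omega), mul_zero]

theorem IsBlockUpper.toPt_mem_NTJ {X Y : Matrix (Fin 18) (Fin 18) K} (hX : IsBlockUpper X)
    (hY : IsBlockUpper Y) (h : X * Y = Y * X) : toPt X Y ∈ NTJ K :=
  ⟨⟨fun i j hij => hX i j (blk_monotone j i hij), fun i j hij => hY i j (blk_monotone j i hij), h⟩,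
    fun i j hij => ⟨hX i j hij.ge, hY i j hij.ge⟩⟩

theorem IsBlockUpper.toPt_add_smul_one_mem_CTset {X Y : Matrix (Fin 18) (Fin 18) K}
    (hX : IsBlockUpper X) (hY : IsBlockUpper Y) (h : X * Y = Y * X) (s t : K) :
    toPt (X + s • 1) (Y + t • 1) ∈ CTset 18 K := by
  have hupper {A : Matrix (Fin 18) (Fin 18) K} (hA : IsBlockUpper A) (c : K) (i j : Fin 18)
      (hij : j < i) : (A + c • 1) i j = 0 := by
    simp [hA i j (blk_monotone j i hij.le), Matrix.one_apply_ne hij.ne']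
  refine ⟨hupper hX s, hupper hY t, ?_⟩
  change (X + s • 1) * (Y + t • 1) = (Y + t • 1) * (X + s • 1)
  simp only [add_mul, mul_add, smul_mul_assoc, mul_smul_comm, one_mul, mul_one, h,
    smul_add, smul_comm s t]
  abel

/-- The elementary matrix at the pivot of a position. -/
def pivotMatrix (K : Type*) [Field K] (e : CommPos) : Matrix (Fin 18) (Fin 18) K :=
  Matrix.single (pivot e.1).1 (pivot e.1).2 1

theorem isBlockUpper_pivotMatrix (e : CommPos) : IsBlockUpper (pivotMatrix K e) := by
  intro i j hij
  refine Matrix.single_apply_of_ne _ _ _ _ _ ?_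
  rintro ⟨rfl, rfl⟩
  exact (blk_pivot_lt e).not_ge hij

theorem mul_pivotMatrix_apply (X : Matrix (Fin 18) (Fin 18) K) (f : CommPos) (i j : Fin 18) :
    (X * pivotMatrix K f) i j = if (pivot f.1).2 = j then X i (pivot f.1).1 else 0 := by
  simp [pivotMatrix, Matrix.mul_apply, Matrix.single_apply, ite_and]

theorem pivotMatrix_mul_apply (X : Matrix (Fin 18) (Fin 18) K) (f : CommPos) (i j : Fin 18) :
    (pivotMatrix K f * X) i j = if (pivot f.1).1 = i then X (pivot f.1).2 j else 0 := by
  simp [pivotMatrix, Matrix.mul_apply, Matrix.single_apply, ite_and]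

/-- The relevant entries of the commutator. -/
def commEntries (X Y : Matrix (Fin 18) (Fin 18) K) (e : CommPos) : K :=
  (X * Y - Y * X) e.1.1 e.1.2

/-- The matrix of `Y ↦ [X, Y]` on matrices supported on the pivots. -/
def pivotMinor (X : Matrix (Fin 18) (Fin 18) K) : Matrix CommPos CommPos K :=
  Matrix.of fun e f => commEntries X (pivotMatrix K f) e

/-- The solution of `[X, Y] = 0` that agrees with a multiple of `Z` off the pivots, given by
Cramer's rule. -/
def commuting (X Z : Matrix (Fin 18) (Fin 18) K) : Matrix (Fin 18) (Fin 18) K :=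
  (pivotMinor X).det • Z -
    ∑ f, ((pivotMinor X).adjugate *ᵥ commEntries X Z) f • pivotMatrix K f

theorem isBlockUpper_commuting (X : Matrix (Fin 18) (Fin 18) K) {Z : Matrix (Fin 18) (Fin 18) K}
    (hZ : IsBlockUpper Z) : IsBlockUpper (commuting X Z) := by
  intro i j hij
  simp [commuting, Matrix.sum_apply, hZ i j hij, isBlockUpper_pivotMatrix _ i j hij]

theorem commuting_apply_of_forall_pivot_ne (X Z : Matrix (Fin 18) (Fin 18) K) {i j : Fin 18}
    (h : ∀ e : CommPos, pivot e.1 ≠ (i, j)) :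
    commuting X Z i j = (pivotMinor X).det * Z i j := by
  have h0 (f : CommPos) : pivotMatrix K f i j = 0 :=
    Matrix.single_apply_of_ne _ _ _ _ _ fun hf => h f (Prod.ext hf.1 hf.2)
  simp [commuting, Matrix.sum_apply, h0]

theorem commEntries_commuting (X Z : Matrix (Fin 18) (Fin 18) K) :
    commEntries X (commuting X Z) = 0 := by
  have hlin : commEntries X (commuting X Z) = (pivotMinor X).det • commEntries X Z -
      pivotMinor X *ᵥ ((pivotMinor X).adjugate *ᵥ commEntries X Z) := by
    have hsub : X * commuting X Z - commuting X Z * X =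
        (pivotMinor X).det • (X * Z - Z * X) -
          ∑ f, ((pivotMinor X).adjugate *ᵥ commEntries X Z) f •
            (X * pivotMatrix K f - pivotMatrix K f * X) := by
      simp only [commuting, mul_sub, sub_mul, Finset.mul_sum, Finset.sum_mul, mul_smul_comm,
        smul_mul_assoc, smul_sub, Finset.sum_sub_distrib]
      abel
    funext e
    have he := congrFun (congrFun hsub e.1.1) e.1.2
    rw [Matrix.sub_apply (_ • _), Matrix.sum_apply] at he
    refine he.trans (congrArg₂ _ rfl (Finset.sum_congr rfl fun f _ => mul_comm _ _))
  rw [hlin, Matrix.mulVec_mulVec, Matrix.mul_adjugate, Matrix.smul_mulVec, Matrix.one_mulVec,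
    sub_self]

theorem mul_commuting {X Z : Matrix (Fin 18) (Fin 18) K} (hX : IsBlockUpper X)
    (hZ : IsBlockUpper Z) : X * commuting X Z = commuting X Z * X := by
  ext i j
  by_cases h : blk i + 2 ≤ blk j
  · exact sub_eq_zero.mp (congrFun (commEntries_commuting X Z) ⟨(i, j), h⟩)
  · rw [hX.mul_apply_eq_zero (isBlockUpper_commuting X hZ) h,
      (isBlockUpper_commuting X hZ).mul_apply_eq_zero hX h]

/-- The matrix with entries `1` at the positions of `baseRel`, perturbed by `a`. -/
def perturbedBase (a : BlockPos → K) : Matrix (Fin 18) (Fin 18) K :=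
  Matrix.of fun i j =>
    if h : blk i < blk j then (if baseRel i j then 1 else 0) + a ⟨(i, j), h⟩ else 0

/-- The block strictly upper triangular matrix with given entries off the pivots. -/
def freeMatrix (z : FreePos → K) : Matrix (Fin 18) (Fin 18) K :=
  Matrix.of fun i j =>
    if h : ∃ _ : blk i < blk j, ∀ e : CommPos, pivot e.1 ≠ (i, j) then
      z ⟨⟨(i, j), h.1⟩, h.2⟩ else 0

theorem isBlockUpper_perturbedBase (a : BlockPos → K) : IsBlockUpper (perturbedBase a) :=
  fun _ _ hij => dif_neg hij.not_gt

theorem isBlockUpper_freeMatrix (z : FreePos → K) : IsBlockUpper (freeMatrix z) :=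
  fun _ _ hij => dif_neg fun h => hij.not_gt h.1

theorem freeMatrix_apply (z : FreePos → K) (q : FreePos) :
    freeMatrix z q.1.1.1 q.1.1.2 = z q :=
  dif_pos ⟨q.1.2, q.2⟩

theorem perturbedBase_zero_apply (i j : Fin 18) :
    perturbedBase (0 : BlockPos → K) i j = if baseRel i j then 1 else 0 := by
  by_cases h : blk i < blk j
  · simp [perturbedBase, h]
  · simp [perturbedBase, h, mt (blk_lt_of_baseRel i j) h]

theorem pivotMinor_base_apply (e f : CommPos) :
    pivotMinor (perturbedBase (0 : BlockPos → K)) e f =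
      (if (pivot f.1).2 = e.1.2 ∧ baseRel e.1.1 (pivot f.1).1 then 1 else 0) -
        if (pivot f.1).1 = e.1.1 ∧ baseRel (pivot f.1).2 e.1.2 then 1 else 0 := by
  simp only [pivotMinor, commEntries, Matrix.of_apply, Matrix.sub_apply, mul_pivotMatrix_apply,
    pivotMatrix_mul_apply, perturbedBase_zero_apply, ite_and]

theorem det_pivotMinor_base_ne_zero :
    (pivotMinor (perturbedBase (0 : BlockPos → K))).det ≠ 0 := by
  intro hdet
  obtain ⟨w, hw, hMw⟩ := Matrix.exists_mulVec_eq_zero_iff.mpr hdet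
  have hdiag (e : CommPos) : pivotMinor (perturbedBase (0 : BlockPos → K)) e e ≠ 0 := by
    rw [pivotMinor_base_apply]
    rcases baseRel_pivot_self e with ⟨h, h'⟩ | ⟨h, h'⟩
    · rw [if_pos h, if_neg h', sub_zero]
      exact one_ne_zero
    · rw [if_neg h', if_pos h, zero_sub]
      exact neg_ne_zero.mpr one_ne_zero
  have hsolve (e : CommPos) (he : ∀ f : CommPos, e.1.1 = 0 → f.1.1 ≠ 0 → w f = 0) : w e = 0 := by
    have hsum : ∑ f, pivotMinor (perturbedBase (0 : BlockPos → K)) e f * w f = 0 :=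
      congrFun hMw e
    rw [Finset.sum_eq_single e ?_ (by simp)] at hsum
    · exact (mul_eq_zero.mp hsum).resolve_left (hdiag e)
    · intro f _ hfe
      by_cases hf : e.1.1 = 0 ∧ f.1.1 ≠ 0
      · rw [he f hf.1 hf.2, mul_zero]
      · have := mt (eq_or_of_baseRel_pivot e f) (not_or.mpr ⟨hfe, hf⟩)
        rw [pivotMinor_base_apply, if_neg (not_or.mp this).1, if_neg (not_or.mp this).2, sub_zero,
          zero_mul]
  have hne (f : CommPos) (hf : f.1.1 ≠ 0) : w f = 0 := hsolve f fun _ h0 => absurd h0 hf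
  exact hw (funext fun e => hsolve e fun f _ hf => hne f hf)

section Polynomial

variable {σ : Type*} {A B : (σ → K) → Matrix (Fin 18) (Fin 18) K}

theorem isPolyFun_commEntries (hA : ∀ i j, IsPolyFun fun a => A a i j)
    (hB : ∀ i j, IsPolyFun fun a => B a i j) (e : CommPos) :
    IsPolyFun fun a => commEntries (A a) (B a) e :=
  (IsPolyFun.matrix_mul hA hB _ _).sub (IsPolyFun.matrix_mul hB hA _ _)

theorem isPolyFun_pivotMinor (hA : ∀ i j, IsPolyFun fun a => A a i j) (e f : CommPos) :
    IsPolyFun fun a => pivotMinor (A a) e f :=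
  isPolyFun_commEntries (B := fun _ => pivotMatrix K f) hA (fun _ _ => .const _) e

theorem isPolyFun_commuting (hA : ∀ i j, IsPolyFun fun a => A a i j)
    (hB : ∀ i j, IsPolyFun fun a => B a i j) (i j : Fin 18) :
    IsPolyFun fun a => commuting (A a) (B a) i j := by
  simp only [commuting, Matrix.sub_apply, Matrix.sum_apply, Matrix.smul_apply, smul_eq_mul]
  exact ((IsPolyFun.det (isPolyFun_pivotMinor hA)).mul (hB i j)).sub <| .sum _ fun f =>
    (IsPolyFun.mulVec (IsPolyFun.adjugate (isPolyFun_pivotMinor hA))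
      (isPolyFun_commEntries hA hB) f).mul (.const _)

theorem isPolyFun_perturbedBase (g : BlockPos → σ) (i j : Fin 18) :
    IsPolyFun fun a : σ → K => perturbedBase (a ∘ g) i j := by
  by_cases h : blk i < blk j
  · simpa [perturbedBase, h] using (IsPolyFun.const _).add (.coord _)
  · simpa [perturbedBase, h] using IsPolyFun.const (0 : K)

theorem isPolyFun_freeMatrix (g : FreePos → σ) (i j : Fin 18) :
    IsPolyFun fun a : σ → K => freeMatrix (a ∘ g) i j := by
  by_cases h : ∃ _ : blk i < blk j, ∀ e : CommPos, pivot e.1 ≠ (i, j)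
  · simpa only [freeMatrix, Matrix.of_apply, dif_pos h, Function.comp_apply] using IsPolyFun.coord _
  · simpa only [freeMatrix, Matrix.of_apply, dif_neg h] using IsPolyFun.const (0 : K)

end Polynomial

theorem exists_commuting_block_family (K : Type*) [Field K] {σ : Type*}
    (g : BlockPos ⊕ FreePos → σ) :
    ∃ (X Y : (σ → K) → Matrix (Fin 18) (Fin 18) K) (D : (σ → K) → K),
      (∀ a, IsBlockUpper (X a)) ∧ (∀ a, IsBlockUpper (Y a)) ∧ (∀ a, X a * Y a = Y a * X a) ∧
      (∀ i j, IsPolyFun fun a => X a i j) ∧ (∀ i j, IsPolyFun fun a => Y a i j) ∧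
      IsPolyFun D ∧ D 0 ≠ 0 ∧
      (∀ a (p : BlockPos), X a p.1.1 p.1.2 =
        (if baseRel p.1.1 p.1.2 then 1 else 0) + a (g (.inl p))) ∧
      ∀ a (q : FreePos), Y a q.1.1.1 q.1.1.2 = a (g (.inr q)) * D a := by
  have hX := isPolyFun_perturbedBase (K := K) (g ∘ Sum.inl)
  refine ⟨fun a => perturbedBase (a ∘ g ∘ Sum.inl),
    fun a => commuting (perturbedBase (a ∘ g ∘ Sum.inl)) (freeMatrix (a ∘ g ∘ Sum.inr)),
    fun a => (pivotMinor (perturbedBase (a ∘ g ∘ Sum.inl))).det,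
    fun _ => isBlockUpper_perturbedBase _,
    fun _ => isBlockUpper_commuting _ (isBlockUpper_freeMatrix _),
    fun _ => mul_commuting (isBlockUpper_perturbedBase _) (isBlockUpper_freeMatrix _),
    hX, isPolyFun_commuting hX (isPolyFun_freeMatrix _), .det (isPolyFun_pivotMinor hX),
    det_pivotMinor_base_ne_zero, fun a p => dif_pos p.2, fun a q => ?_⟩
  refine (commuting_apply_of_forall_pivot_ne _ _ q.2).trans ?_
  rw [freeMatrix_apply, mul_comm]
  rfl

theorem le_topologicalKrullDim_NTJ [Infinite K] :
    ((188 : ℕ) : WithBot ℕ∞) ≤ topologicalKrullDim (NTJ K) := by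
  obtain ⟨X, Y, D, hX, hY, hXY, hXp, hYp, hD, hD0, hXe, hYe⟩ := exists_commuting_block_family K id
  rw [← card_blockPos_sum_freePos]
  refine card_le_topologicalKrullDim (e := Subtype.val) ⟨rfl⟩
    (fun a => ⟨toPt (X a) (Y a), (hX a).toPt_mem_NTJ (hY a) (hXY a)⟩) ?_
    (Sum.elim (fun p => .inl p.1) fun q => .inr q.1.1)
    (Sum.elim (fun p => if baseRel p.1.1 p.1.2 then 1 else 0) 0)
    (Sum.elim (fun _ _ => 1) fun _ => D) ?_ ?_ ?_
  · rintro (p | p)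
    exacts [hXp _ _, hYp _ _]
  · rintro (p | q)
    exacts [.const _, hD]
  · rintro (p | q)
    exacts [one_ne_zero, hD0]
  · rintro a (p | q)
    · simpa [toPt] using hXe a p
    · simpa [toPt] using hYe a q

/-- The translates of the block strictly upper triangular pairs by scalar matrices give an
irreducible subset of `CT_18` all of whose supersets have dimension at least `190`. -/
theorem exists_isIrreducible_CTset (K : Type*) [Field K] [Infinite K] :
    ∃ Z : Set (CTset 18 K), IsIrreducible Z ∧ ∀ C : Set (CTset 18 K), Z ⊆ C →
      ((190 : ℕ) : WithBot ℕ∞) ≤ topologicalKrullDim C := by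
  obtain ⟨X, Y, D, hX, hY, hXY, hXp, hYp, hD, hD0, hXe, hYe⟩ :=
    exists_commuting_block_family K (Sum.inl : _ → (BlockPos ⊕ FreePos) ⊕ Fin 2)
  let ψ (a : (BlockPos ⊕ FreePos) ⊕ Fin 2 → K) : CTset 18 K :=
    ⟨toPt (X a + a (.inr 0) • 1) (Y a + a (.inr 1) • 1),
      (hX a).toPt_add_smul_one_mem_CTset (hY a) (hXY a) _ _⟩
  have hψ (c) : IsPolyFun fun a => (ψ a : Pt 18 K) c := by
    rcases c with c | c
    · exact (hXp _ _).add ((IsPolyFun.coord _).mul (.const _))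
    · exact (hYp _ _).add ((IsPolyFun.coord _).mul (.const _))
  refine ⟨Set.range ψ, isIrreducible_range_of_isPolyFun ⟨rfl⟩ ψ hψ, fun C hC => ?_⟩
  have hcard : Fintype.card ((BlockPos ⊕ FreePos) ⊕ Fin 2) = 190 := by
    rw [Fintype.card_sum, card_blockPos_sum_freePos, Fintype.card_fin]
  rw [← hcard]
  have hne {p : Fin 18 × Fin 18} (hp : blk p.1 < blk p.2) : p.1 ≠ p.2 := fun h => by
    simp [h] at hp
  refine card_le_topologicalKrullDim (e := fun x : C => (x : Pt 18 K))
    (Topology.IsInducing.subtypeVal.comp Topology.IsInducing.subtypeVal)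
    (fun a => ⟨ψ a, hC ⟨a, rfl⟩⟩) hψ
    (Sum.elim (Sum.elim (fun p => .inl p.1) fun q => .inr q.1.1) ![.inl (0, 0), .inr (0, 0)])
    (Sum.elim (Sum.elim (fun p => if baseRel p.1.1 p.1.2 then 1 else 0) 0) 0)
    (Sum.elim (Sum.elim (fun _ _ => 1) fun _ => D) fun _ _ => 1) ?_ ?_ ?_
  · rintro ((p | q) | m)
    exacts [.const _, hD, .const _]
  · rintro ((p | q) | m)
    exacts [one_ne_zero, hD0, one_ne_zero]
  · rintro a ((p | q) | m)
    · simpa [ψ, toPt, Matrix.one_apply_ne (hne p.2)] using hXe a p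
    · simpa [ψ, toPt, Matrix.one_apply_ne (hne q.1.2)] using hYe a q
    · fin_cases m
      · simp [ψ, toPt, hX a 0 0 le_rfl]
      · simp [ψ, toPt, hY a 0 0 le_rfl]

end CommutingPairs

/-- `dim NT_18^J ≥ 188`; hence `CT_18` contains a subvariety of dimension at least
`190 > 189 = dim CT_18^0`, and `CT_18` has an irreducible component of dimension
exceeding `189`, so it is not a complete intersection. -/
theorem stmt17 (K : Type*) [Field K] [IsAlgClosed K] :
    ((188 : ℕ) : WithBot ℕ∞) ≤ topologicalKrullDim (NTJ K) ∧
    (∃ S : Set (Pt 18 K), S ⊆ CTset 18 K ∧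
      ((190 : ℕ) : WithBot ℕ∞) ≤ topologicalKrullDim S) ∧
    (∃ C ∈ irreducibleComponents ↥(CTset 18 K),
      ((189 : ℕ) : WithBot ℕ∞) < topologicalKrullDim C) := by
  obtain ⟨Z, hZ, hdim⟩ := exists_isIrreducible_CTset K
  obtain ⟨C, hC, hZC⟩ := exists_mem_irreducibleComponents_subset_of_isIrreducible Z hZ
  refine ⟨le_topologicalKrullDim_NTJ, ⟨CTset 18 K, subset_rfl, ?_⟩, C, hC, ?_⟩
  · exact (hdim C hZC).trans Topology.IsInducing.subtypeVal.topologicalKrullDim_le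
  · exact lt_of_lt_of_le (by norm_cast) (hdim C hZC)
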